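/- For real η₁, η₂, η₃, the symbol 𝐓_1(η₁,η₂,η₃) = ∫_ℝ (1−e^{iη₁ζ})(1−e^{iη₂ζ})(1−e^{iη₃ζ})/|ζ|³ dζ equals −η₁² log|η₁| − η₂² log|η₂| − η₃² log|η₃| − (η₁+η₂+η₃)² log|η₁+η₂+η₃| + (η₁+η₂)² log|η₁+η₂| + (η₁+η₃)² log|η₁+η₃| + (η₂+η₃)² log|η₂+η₃|, with the convention 0·log 0 = 0. -/

import Mathlib

open MeasureTheory Set Filter Topology

lemma aux_gamma {z : ℝ} (hz : 0 < z) :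
    IntegrableOn (fun t : ℝ => t ^ 2 * Real.exp (-(z * t))) (Ioi 0) ∧
    ∫ t in Ioi (0:ℝ), t ^ 2 * Real.exp (-(z * t)) = 2 / z ^ 3 := by
  have key := Real.integral_rpow_mul_exp_neg_mul_Ioi (a := 3) (by norm_num) hz
  have h2 : ∀ t : ℝ, t ^ ((3:ℝ) - 1) = t ^ 2 := by
    intro t
    rw [show (3:ℝ) - 1 = ((2:ℕ):ℝ) by norm_num, Real.rpow_natCast]
  have hG : Real.Gamma 3 = 2 := by
    have := Real.Gamma_nat_eq_factorial 2
    rw [show ((2:ℕ):ℝ) + 1 = 3 by norm_num] at this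
    rw [this]
    norm_num [Nat.factorial]
  have h3 : (1 / z) ^ (3:ℝ) = 1 / z ^ 3 := by
    rw [show (3:ℝ) = ((3:ℕ):ℝ) by norm_num, Real.rpow_natCast, div_pow, one_pow]
  simp_rw [h2] at key
  rw [hG, h3] at key
  have key' : ∫ t in Ioi (0:ℝ), t ^ 2 * Real.exp (-(z * t)) = 2 / z ^ 3 := by
    rw [key]; ring
  refine ⟨Integrable.of_integral_ne_zero ?_, key'⟩
  rw [key']
  positivity

lemma aux_laplace (a : ℝ) {t : ℝ} (ht : 0 < t) :
    IntegrableOn (fun z : ℝ => Real.cos (a * z) * Real.exp (-(z * t))) (Ioi 0) ∧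
    ∫ z in Ioi (0:ℝ), Real.cos (a * z) * Real.exp (-(z * t)) = t / (t ^ 2 + a ^ 2) := by
  have hre : ((-t : ℂ) + a * Complex.I).re < 0 := by simpa using ht
  have h1 := integrableOn_exp_mul_complex_Ioi hre 0
  have h2 := integral_exp_mul_complex_Ioi hre 0
  have h3 : ∀ z : ℝ, Real.cos (a * z) * Real.exp (-(z * t)) =
      RCLike.re (Complex.exp (((-t : ℂ) + a * Complex.I) * z)) := by
    intro z
    simp [Complex.exp_re]
    ring_nf
  simp_rw [h3]
  refine ⟨h1.re, ?_⟩
  rw [integral_re h1, h2]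
  simp [Complex.div_re, Complex.normSq_apply]
  ring_nf

lemma aux_core {n : ℕ} (c a : Fin n → ℝ) (h0 : ∑ i, c i = 0) (h2 : ∑ i, c i * a i ^ 2 = 0)
    (hint : IntegrableOn (fun z : ℝ => (∑ i, c i * Real.cos (a i * z)) / z ^ 3) (Ioi 0)) :
    ∫ z in Ioi (0:ℝ), (∑ i, c i * Real.cos (a i * z)) / z ^ 3 =
      (1 / 2) * ∑ i, c i * a i ^ 2 * Real.log |a i| := by
  set g : ℝ → ℝ := fun z => ∑ i, c i * Real.cos (a i * z) with hg
  have hgc : Continuous g := by fun_prop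
  set f : ℝ → ℝ → ℝ := fun z t => g z * (t ^ 2 * Real.exp (-(z * t))) with hf
  have hF : Integrable (Function.uncurry f)
      ((volume.restrict (Ioi (0:ℝ))).prod (volume.restrict (Ioi (0:ℝ)))) := by
    rw [integrable_prod_iff]
    · constructor
      · refine (ae_restrict_iff' measurableSet_Ioi).2 (ae_of_all _ fun z hz => ?_)
        exact (aux_gamma hz).1.const_mul (g z)
      · refine (hint.norm.const_mul 2).congr ?_
        refine (ae_restrict_iff' measurableSet_Ioi).2 (ae_of_all _ fun z hz => ?_)
        have hz' : (0:ℝ) < z := hz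
        have : ∀ t : ℝ, ‖Function.uncurry f (z, t)‖ = |g z| * (t ^ 2 * Real.exp (-(z * t))) := by
          intro t
          simp [hf, Function.uncurry, abs_mul]
        simp_rw [this]
        rw [integral_const_mul, (aux_gamma hz').2]
        rw [Real.norm_eq_abs, abs_div, abs_of_pos (pow_pos hz' 3)]
        ring
    · apply Continuous.aestronglyMeasurable
      simp only [hf, Function.uncurry_def]
      fun_prop
  have hswap := integral_integral_swap hF
  have hL : ∫ z in Ioi (0:ℝ), ∫ t in Ioi (0:ℝ), f z t = 2 * ∫ z in Ioi (0:ℝ), g z / z ^ 3 := by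
    rw [← integral_const_mul]
    refine setIntegral_congr_fun measurableSet_Ioi fun z hz => ?_
    simp only [hf]
    rw [integral_const_mul, (aux_gamma hz).2]
    ring
  have hI : ∀ t ∈ Ioi (0:ℝ), ∫ z in Ioi (0:ℝ), f z t =
      ∑ i, -(c i * a i ^ 2 * (t / (t ^ 2 + a i ^ 2))) := by
    intro t ht
    have ht' : (0:ℝ) < t := ht
    have e1 : ∀ z, f z t = ∑ i, (c i * t ^ 2) * (Real.cos (a i * z) * Real.exp (-(z * t))) := by
      intro z
      simp only [hf, hg, Finset.sum_mul]
      refine Finset.sum_congr rfl fun i _ => by ring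
    simp_rw [e1]
    rw [integral_finsetSum _ fun i _ => (aux_laplace (a i) ht').1.const_mul _]
    have e2 : ∀ i, ∫ z in Ioi (0:ℝ), (c i * t ^ 2) * (Real.cos (a i * z) * Real.exp (-(z * t)))
        = c i * t + -(c i * a i ^ 2 * (t / (t ^ 2 + a i ^ 2))) := by
      intro i
      rw [integral_const_mul, (aux_laplace (a i) ht').2]
      have : t ^ 2 + a i ^ 2 ≠ 0 := by positivity
      field_simp
      ring
    simp_rw [e2]
    rw [Finset.sum_add_distrib, ← Finset.sum_mul, h0]
    simp
  have hR := setIntegral_congr_fun (μ := volume) measurableSet_Ioi hI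
  have hRint : IntegrableOn (fun t : ℝ => ∑ i, -(c i * a i ^ 2 * (t / (t ^ 2 + a i ^ 2))))
      (Ioi 0) := by
    refine hF.integral_prod_right.congr ?_
    exact (ae_restrict_iff' measurableSet_Ioi).2 (ae_of_all _ hI)
  have hFTC : ∫ t in Ioi (0:ℝ), ∑ i, -(c i * a i ^ 2 * (t / (t ^ 2 + a i ^ 2))) =
      0 - ∑ i, -(c i * a i ^ 2 * (Real.log ((0:ℝ) ^ 2 + a i ^ 2) / 2)) := by
    refine integral_Ioi_of_hasDerivAt_of_tendsto
      (f := fun t : ℝ => ∑ i, -(c i * a i ^ 2 * (Real.log (t ^ 2 + a i ^ 2) / 2))) ?_ ?_ hRint ?_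
    · apply ContinuousAt.continuousWithinAt
      refine tendsto_finsetSum _ fun i _ => ?_
      by_cases h : a i = 0
      · simp [h]
      · have : (0:ℝ) ^ 2 + a i ^ 2 ≠ 0 := by positivity
        have hc : ContinuousAt (fun t : ℝ => t ^ 2 + a i ^ 2) 0 := by fun_prop
        exact ((continuousAt_const.mul ((hc.log this).div_const 2))).neg
    · intro t ht
      have ht' : (0:ℝ) < t := ht
      refine HasDerivAt.fun_sum fun i _ => ?_
      have hne : t ^ 2 + a i ^ 2 ≠ 0 := by positivity
      have hd : HasDerivAt (fun t : ℝ => t ^ 2 + a i ^ 2) (2 * t) t := by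
        simpa using (hasDerivAt_pow 2 t).add_const (a i ^ 2)
      refine ((((hd.log hne).div_const 2).const_mul (c i * a i ^ 2)).neg).congr_deriv ?_
      field_simp
    · have hlim : Tendsto (fun t : ℝ => ∑ i, -(c i * a i ^ 2 *
          (Real.log (1 + a i ^ 2 / t ^ 2) / 2))) atTop (𝓝 0) := by
        have : (0:ℝ) = ∑ i, -(c i * a i ^ 2 * (Real.log (1 + 0) / 2)) := by simp
        rw [this]
        refine tendsto_finsetSum _ fun i _ => ?_
        refine (Tendsto.const_mul _ (Tendsto.div_const ?_ 2)).neg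
        refine (Real.continuousAt_log (by norm_num)).tendsto.comp ?_
        refine tendsto_const_nhds.add ?_
        exact tendsto_const_nhds.div_atTop (tendsto_pow_atTop (by norm_num))
      refine hlim.congr' ?_
      filter_upwards [eventually_gt_atTop 0] with t ht
      have e : ∀ i, -(c i * a i ^ 2 * (Real.log (t ^ 2 + a i ^ 2) / 2)) =
          -(c i * a i ^ 2 * (Real.log (1 + a i ^ 2 / t ^ 2) / 2)) +
            (c i * a i ^ 2) * (-(Real.log (t ^ 2) / 2)) := by
        intro i
        have : t ^ 2 + a i ^ 2 = (1 + a i ^ 2 / t ^ 2) * t ^ 2 := by field_simp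
        rw [this, Real.log_mul (by positivity) (by positivity)]
        ring
      simp_rw [e]
      rw [Finset.sum_add_distrib, ← Finset.sum_mul, h2]
      simp
  have hlog : ∀ i, Real.log ((0:ℝ) ^ 2 + a i ^ 2) / 2 = Real.log |a i| := by
    intro i
    rw [zero_pow two_ne_zero, zero_add, ← sq_abs, Real.log_pow]
    push_cast
    ring
  rw [hL, hR, hFTC] at hswap
  simp_rw [hlog] at hswap
  rw [Finset.sum_neg_distrib] at hswap
  linarith

lemma aux_norm1 (x z : ℝ) : ‖1 - Complex.exp (Complex.I * x * z)‖ ≤ |x| * |z| := by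
  have := Real.norm_exp_I_mul_ofReal_sub_one_le (x := x * z)
  rw [norm_sub_rev, mul_assoc, ← Complex.ofReal_mul]
  simpa [abs_mul] using this

lemma aux_norm2 (x z : ℝ) : ‖1 - Complex.exp (Complex.I * x * z)‖ ≤ 2 := by
  refine (norm_sub_le _ _).trans ?_
  have : Complex.I * x * z = ((x * z : ℝ) : ℂ) * Complex.I := by push_cast; ring
  rw [this, Complex.norm_exp_ofReal_mul_I]
  norm_num

lemma aux_int (x y w : ℝ) : Integrable (fun ζ : ℝ => ((1 - Complex.exp (Complex.I * x * ζ)) *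
        (1 - Complex.exp (Complex.I * y * ζ)) *
        (1 - Complex.exp (Complex.I * w * ζ))) / ((|ζ| : ℝ) : ℂ) ^ 3) := by
  refine (integrable_inv_one_add_sq.const_mul (2 * (|x| * |y| * |w|) + 16)).mono' ?_ ?_
  · apply Measurable.aestronglyMeasurable
    fun_prop
  · refine ae_of_all _ fun z => ?_
    rw [norm_div, norm_mul, norm_mul, norm_pow, Complex.norm_real, Real.norm_eq_abs, abs_abs]
    by_cases hz : z = 0
    · subst hz
      simp
      positivity
    have hz' : 0 < |z| := abs_pos.2 hz
    rw [← div_eq_mul_inv, div_le_div_iff₀ (by positivity) (by positivity), ← sq_abs z]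
    set r := |z|
    have hx := aux_norm1 x z
    have hy := aux_norm1 y z
    have hw := aux_norm1 w z
    have hx2 := aux_norm2 x z
    have hy2 := aux_norm2 y z
    have hw2 := aux_norm2 w z
    have b1 : ‖1 - Complex.exp (Complex.I * x * z)‖ * ‖1 - Complex.exp (Complex.I * y * z)‖ *
      ‖1 - Complex.exp (Complex.I * w * z)‖ ≤ (|x| * r) * (|y| * r) * (|w| * r) := by gcongr
    have b2 : ‖1 - Complex.exp (Complex.I * x * z)‖ * ‖1 - Complex.exp (Complex.I * y * z)‖ *
      ‖1 - Complex.exp (Complex.I * w * z)‖ ≤ 2 * 2 * 2 := by gcongr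
    have hA : 0 ≤ |x| * |y| * |w| := by positivity
    rcases le_total r 1 with h | h
    · have h1 : 1 + r ^ 2 ≤ 2 := by nlinarith
      calc _ ≤ ((|x| * r) * (|y| * r) * (|w| * r)) * 2 := by gcongr
        _ = 2 * (|x| * |y| * |w|) * r ^ 3 := by ring
        _ ≤ _ := by gcongr; linarith
    · have h1 : 1 + r ^ 2 ≤ 2 * r ^ 3 := by
        have : 1 ≤ r ^ 2 := one_le_pow₀ h
        nlinarith
      calc _ ≤ (2 * 2 * 2) * (2 * r ^ 3) := by gcongr
        _ = 16 * r ^ 3 := by ring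
        _ ≤ _ := by gcongr; linarith

lemma aux_sym (x y w z : ℝ) :
    (1 - Complex.exp (Complex.I * x * z)) * (1 - Complex.exp (Complex.I * y * z)) *
        (1 - Complex.exp (Complex.I * w * z)) +
    (1 - Complex.exp (Complex.I * x * (-z : ℝ))) * (1 - Complex.exp (Complex.I * y * (-z : ℝ))) *
        (1 - Complex.exp (Complex.I * w * (-z : ℝ))) =
    ((2 * (1 - Real.cos (x * z) - Real.cos (y * z) - Real.cos (w * z) + Real.cos ((x + y) * z)
      + Real.cos ((x + w) * z) + Real.cos ((y + w) * z) - Real.cos ((x + y + w) * z)) : ℝ) : ℂ) := by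
  have e : ∀ u : ℝ, ((Real.cos (u * z) : ℝ) : ℂ) =
      (Complex.exp (Complex.I * u * z) + Complex.exp (Complex.I * u * (-z : ℝ))) / 2 := by
    intro u
    rw [Complex.ofReal_cos, Complex.cos]
    push_cast
    ring_nf
  simp only [Complex.ofReal_mul, Complex.ofReal_sub, Complex.ofReal_add (Real.cos _), Complex.ofReal_add (_ + _), Complex.ofReal_add (_ - _), e, Complex.ofReal_one,
    Complex.ofReal_ofNat]
  simp only [Complex.ofReal_add, mul_add, add_mul, Complex.exp_add]
  ring

open Complex in
/-- Explicit evaluation of the cubic symbol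
`𝐓₁(η₁,η₂,η₃) = ∫ (1-e^{iη₁ζ})(1-e^{iη₂ζ})(1-e^{iη₃ζ})/|ζ|³ dζ`
as a seven-term logarithmic expression (with the convention `0·log 0 = 0`,
built into `Real.log 0 = 0`). -/
theorem stmt13 (η₁ η₂ η₃ : ℝ) :
    (∫ ζ : ℝ, ((1 - Complex.exp (Complex.I * η₁ * ζ)) *
        (1 - Complex.exp (Complex.I * η₂ * ζ)) *
        (1 - Complex.exp (Complex.I * η₃ * ζ))) / ((|ζ| : ℝ) : ℂ) ^ 3)
      = ((-(η₁ ^ 2 * Real.log |η₁|) - η₂ ^ 2 * Real.log |η₂| - η₃ ^ 2 * Real.log |η₃| -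
          (η₁ + η₂ + η₃) ^ 2 * Real.log |η₁ + η₂ + η₃| +
          (η₁ + η₂) ^ 2 * Real.log |η₁ + η₂| + (η₁ + η₃) ^ 2 * Real.log |η₁ + η₃| +
          (η₂ + η₃) ^ 2 * Real.log |η₂ + η₃| : ℝ) : ℂ) := by
  have hI := aux_int η₁ η₂ η₃
  set h : ℝ → ℂ := fun ζ : ℝ => ((1 - Complex.exp (Complex.I * η₁ * ζ)) *
        (1 - Complex.exp (Complex.I * η₂ * ζ)) *
        (1 - Complex.exp (Complex.I * η₃ * ζ))) / ((|ζ| : ℝ) : ℂ) ^ 3 with hh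
  let c : Fin 8 → ℝ := ![1, -1, -1, -1, 1, 1, 1, -1]
  let a : Fin 8 → ℝ := ![0, η₁, η₂, η₃, η₁ + η₂, η₁ + η₃, η₂ + η₃, η₁ + η₂ + η₃]
  have hsum : ∀ z ∈ Ioi (0:ℝ), h z + h (-z) =
      ((2 * ((∑ i, c i * Real.cos (a i * z)) / z ^ 3) : ℝ) : ℂ) := by
    intro z hz
    have hz' : (0:ℝ) < z := hz
    have e := aux_sym η₁ η₂ η₃ z
    simp only [hh]
    rw [abs_neg, abs_of_pos hz', ← add_div, e, ← Complex.ofReal_pow, ← Complex.ofReal_div]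
    congr 1
    simp [Fin.sum_univ_eight, c, a]
    ring
  have hneg : Integrable (fun z => h (-z)) := hI.comp_neg
  have hint : IntegrableOn (fun z : ℝ => (∑ i, c i * Real.cos (a i * z)) / z ^ 3) (Ioi 0) := by
    have h1 : IntegrableOn (fun z => h z + h (-z)) (Ioi 0) := (hI.add hneg).integrableOn
    have h2 := (h1.congr_fun hsum measurableSet_Ioi).re.const_mul (1 / 2)
    refine h2.congr (ae_of_all _ fun z => ?_)
    simp only [RCLike.re_to_complex, Complex.ofReal_re]
    ring
  have hcore := aux_core c a (by simp [Fin.sum_univ_eight, c])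
    (by simp [Fin.sum_univ_eight, c, a]; ring) hint
  rw [← intervalIntegral.integral_Iic_add_Ioi hI.integrableOn hI.integrableOn (b := 0)]
  have hn : ∫ z in Iic (0:ℝ), h z = ∫ z in Ioi (0:ℝ), h (-z) := by
    rw [integral_comp_neg_Ioi (f := h)]
    simp
  rw [hn, add_comm, ← integral_add hI.integrableOn hneg.integrableOn,
    setIntegral_congr_fun measurableSet_Ioi hsum, integral_complex_ofReal, integral_const_mul, hcore]
  congr 1
  simp [Fin.sum_univ_eight, c, a]
  ring
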